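/- Let X be a real Banach space, a < b real numbers, and u, u', u'' : ℝ → X functions such that u' and u'' are Bochner integrable on [a,b], ‖u''(·)‖² is integrable on [a,b], u(t) = u(a) + ∫_a^t u'(s) ds and u'(t) = u'(a) + ∫_a^t u''(s) ds for all t ∈ [a,b]. Then for every t ∈ [a,b], ‖u'(t) − (u(b) − u(a))/(b−a)‖² ≤ (b−a)·∫_a^b ‖u''(r)‖² dr. -/

import Mathlib

open MeasureTheory intervalIntegral

/-- Cauchy–Schwarz for a function against the constant `1` on an interval. -/
theorem sq_intervalIntegral_le_mul_intervalIntegral_sq {a b : ℝ} (hab : a < b) {f : ℝ → ℝ}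
    (hf : IntervalIntegrable f volume a b)
    (hf2 : IntervalIntegrable (fun r => f r ^ 2) volume a b) :
    (∫ r in a..b, f r) ^ 2 ≤ (b - a) * ∫ r in a..b, f r ^ 2 := by
  have hba : 0 < b - a := sub_pos.2 hab
  set m := (∫ r in a..b, f r) / (b - a) with hm
  have hM : ∫ r in a..b, f r = m * (b - a) := by rw [hm, div_mul_cancel₀ _ hba.ne']
  have hnonneg : 0 ≤ ∫ r in a..b, (f r ^ 2 - 2 * m * f r + m ^ 2) :=
    integral_nonneg hab.le fun r _ => by nlinarith [sq_nonneg (f r - m)]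
  rw [integral_add (hf2.sub (hf.const_mul _)) intervalIntegrable_const,
    integral_sub hf2 (hf.const_mul _), intervalIntegral.integral_const_mul,
    intervalIntegral.integral_const, smul_eq_mul, hM] at hnonneg
  rw [hM]
  nlinarith [mul_nonneg hba.le hnonneg]

/-- If `f` oscillates by at most `C` around `x` on an interval, its mean is within `C` of `x`. -/
theorem norm_sub_inv_smul_intervalIntegral_le {X : Type*} [NormedAddCommGroup X]
    [NormedSpace ℝ X] [CompleteSpace X] {a b C : ℝ} (hab : a < b) {f : ℝ → X} (x : X)
    (hf : IntervalIntegrable f volume a b) (h : ∀ s ∈ Set.Icc a b, ‖x - f s‖ ≤ C) :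
    ‖x - (b - a)⁻¹ • ∫ s in a..b, f s‖ ≤ C := by
  have hba : 0 < b - a := sub_pos.2 hab
  have hmean : x - (b - a)⁻¹ • ∫ s in a..b, f s = (b - a)⁻¹ • ∫ s in a..b, (x - f s) := by
    rw [integral_sub intervalIntegrable_const hf, intervalIntegral.integral_const, smul_sub,
      inv_smul_smul₀ hba.ne']
  have hbound : ‖∫ s in a..b, (x - f s)‖ ≤ C * |b - a| :=
    norm_integral_le_of_norm_le_const fun s hs =>
      h s (Set.Ioc_subset_Icc_self (Set.uIoc_of_le hab.le ▸ hs))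
  rw [abs_of_pos hba] at hbound
  rw [hmean, norm_smul, norm_inv, Real.norm_of_nonneg hba.le, inv_mul_le_iff₀ hba, mul_comm]
  exact hbound

/-- Pointwise bound from the proof of Lemma 4.1 (thm:tp:lagrange):
`‖u' t − (u b − u a)/(b−a)‖² ≤ (b−a)·∫_a^b ‖u''‖²`. -/
theorem linear_interpolant_derivative_pointwise_bound
    {X : Type*} [NormedAddCommGroup X] [NormedSpace ℝ X] [CompleteSpace X]
    (a b : ℝ) (hab : a < b) (u u' u'' : ℝ → X)
    (hint1 : IntervalIntegrable u' volume a b)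
    (hint2 : IntervalIntegrable u'' volume a b)
    (hint3 : IntervalIntegrable (fun r => ‖u'' r‖ ^ 2) volume a b)
    (hu : ∀ t ∈ Set.Icc a b, u t = u a + ∫ s in a..t, u' s)
    (hu' : ∀ t ∈ Set.Icc a b, u' t = u' a + ∫ s in a..t, u'' s) :
    ∀ t ∈ Set.Icc a b,
      ‖u' t - (b - a)⁻¹ • (u b - u a)‖ ^ 2 ≤
        (b - a) * ∫ r in a..b, ‖u'' r‖ ^ 2 := by
  intro t ht
  have hosc : ∀ s ∈ Set.Icc a b, ‖u' t - u' s‖ ≤ ∫ r in a..b, ‖u'' r‖ := by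
    intro s hs
    have hsub : ∀ c ∈ Set.Icc a b, IntervalIntegrable u'' volume a c := fun c hc =>
      hint2.mono_set (Set.uIcc_subset_uIcc_left (Set.Icc_subset_uIcc hc))
    rw [hu' t ht, hu' s hs, add_sub_add_left_eq_sub,
      integral_interval_sub_left (hsub t ht) (hsub s hs)]
    refine norm_integral_le_integral_norm_uIoc.trans ?_
    rw [integral_of_le hab.le]
    refine setIntegral_mono_set hint2.norm.1 (.of_forall fun _ => norm_nonneg _)
      (Set.Ioc_subset_Ioc (le_min hs.1 ht.1) (max_le hs.2 ht.2)).eventuallyLE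
  have hmean := norm_sub_inv_smul_intervalIntegral_le hab (u' t) hint1 hosc
  rw [hu b (Set.right_mem_Icc.2 hab.le), add_sub_cancel_left]
  exact (pow_le_pow_left₀ (norm_nonneg _) hmean 2).trans
    (sq_intervalIntegral_le_mul_intervalIntegral_sq hab hint2.norm hint3)
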